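/- arXiv:2206.02275 — 5 statements merged into one kernel-verified Lean document; each statement's English description precedes it below -/
import Mathlib

section
/- Let S be a sampling satisfying the weighted AB inequality with constants A ≥ B ≥ 0 and weights (w_1,…,w_n), and let L₊,w and L±,w be constants as in the definitions. Then for all x, y ∈ ℝ^d: E‖S(∇f_1(x) − ∇f_1(y), …, ∇f_n(x) − ∇f_n(y)) − (∇f(x) − ∇f(y))‖² ≤ ((A − B)·L₊,w² + B·L±,w²)·‖x − y‖². -/
open Finset MeasureTheory

/-- Variance bound for a sampling applied to gradient differences: if the sampling `S`
satisfies the weighted AB inequality with constants `A ≥ B ≥ 0` and weights `w`, and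
`L₊,w`, `L±,w` are the corresponding weighted smoothness constants, then
`E‖S(∇f₁(x)−∇f₁(y),…,∇fₙ(x)−∇fₙ(y)) − (∇f(x)−∇f(y))‖² ≤ ((A−B)L₊,w² + B L±,w²)‖x−y‖²`. -/
theorem sampling_gradient_variance_bound
    {d n : ℕ} (hn : 0 < n)
    {Ω : Type*} [MeasurableSpace Ω] (μ : Measure Ω) [IsProbabilityMeasure μ]
    (S : (Fin n → EuclideanSpace ℝ (Fin d)) → Ω → EuclideanSpace ℝ (Fin d))
    (hunb : ∀ a : Fin n → EuclideanSpace ℝ (Fin d),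
      ∫ ω, S a ω ∂μ = (1 / (n : ℝ)) • ∑ i, a i)
    (A B : ℝ) (hB0 : 0 ≤ B) (hBA : B ≤ A)
    (w : Fin n → ℝ) (hw : ∀ i, 0 < w i) (hw1 : ∑ i, w i = 1)
    (hAB : ∀ a : Fin n → EuclideanSpace ℝ (Fin d),
      ∫ ω, ‖S a ω - (1 / (n : ℝ)) • ∑ i, a i‖ ^ 2 ∂μ
        ≤ (A / (n : ℝ)) * ∑ i, (1 / ((n : ℝ) * w i)) * ‖a i‖ ^ 2
          - B * ‖(1 / (n : ℝ)) • ∑ i, a i‖ ^ 2)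
    (f : EuclideanSpace ℝ (Fin d) → ℝ)
    (fi : Fin n → EuclideanSpace ℝ (Fin d) → ℝ)
    (f' : EuclideanSpace ℝ (Fin d) → EuclideanSpace ℝ (Fin d))
    (fi' : Fin n → EuclideanSpace ℝ (Fin d) → EuclideanSpace ℝ (Fin d))
    (hf : ∀ x, f x = (1 / (n : ℝ)) * ∑ i, fi i x)
    (hgrad : ∀ x, HasGradientAt f (f' x) x)
    (hgradi : ∀ i x, HasGradientAt (fi i) (fi' i x) x)
    (Lp Lpm : ℝ)
    (hLp : ∀ x y, (1 / (n : ℝ)) * ∑ i, (1 / ((n : ℝ) * w i)) * ‖fi' i x - fi' i y‖ ^ 2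
      ≤ Lp ^ 2 * ‖x - y‖ ^ 2)
    (hLpm : ∀ x y, (1 / (n : ℝ)) * ∑ i, (1 / ((n : ℝ) * w i)) * ‖fi' i x - fi' i y‖ ^ 2
        - ‖f' x - f' y‖ ^ 2 ≤ Lpm ^ 2 * ‖x - y‖ ^ 2)
    (x y : EuclideanSpace ℝ (Fin d)) :
    ∫ ω, ‖S (fun i => fi' i x - fi' i y) ω - (f' x - f' y)‖ ^ 2 ∂μ
      ≤ ((A - B) * Lp ^ 2 + B * Lpm ^ 2) * ‖x - y‖ ^ 2 := by
  have key : ∀ z, f' z = (1 / (n : ℝ)) • ∑ i, fi' i z := by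
    intro z
    have h1 : HasFDerivAt (fun x => (1 / (n : ℝ)) * ∑ i, fi i x)
        ((1 / (n : ℝ)) • ∑ i, (InnerProductSpace.toDual ℝ _) (fi' i z)) z :=
      (HasFDerivAt.fun_sum fun i _ => (hgradi i z).hasFDerivAt).const_mul _
    have h2 : f = fun x => (1 / (n : ℝ)) * ∑ i, fi i x := funext hf
    have h3 := (hgrad z).hasFDerivAt
    rw [h2] at h3
    have h4 := h3.unique h1
    apply (InnerProductSpace.toDual ℝ (EuclideanSpace ℝ (Fin d))).injective
    rw [h4]
    ext v
    simp [InnerProductSpace.toDual_apply_apply, inner_smul_left, sum_inner]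
  have hd : f' x - f' y = (1 / (n : ℝ)) • ∑ i, (fi' i x - fi' i y) := by
    rw [key x, key y, ← smul_sub, Finset.sum_sub_distrib]
  have h := hAB (fun i => fi' i x - fi' i y)
  simp only [← hd] at h
  have hp := mul_le_mul_of_nonneg_left (hLp x y) (sub_nonneg.2 hBA)
  have hq := mul_le_mul_of_nonneg_left (hLpm x y) hB0
  refine h.trans ?_
  rw [div_eq_mul_one_div A (n : ℝ)]
  linarith
end

section
/- Fix x, x⁺, g ∈ ℝ^d and p ∈ (0,1]. Let S be a sampling satisfying the weighted AB inequality with constants A ≥ B ≥ 0 and weights (w_1,…,w_n), let c be a Bernoulli random variable with P(c = 1) = p independent of S, and define the random vector g⁺ = ∇f(x⁺) if c = 1 and g⁺ = g + S(∇f_1(x⁺) − ∇f_1(x), …, ∇f_n(x⁺) − ∇f_n(x)) if c = 0. Then E‖g⁺ − ∇f(x⁺)‖² ≤ (1 − p)·((A − B)·L₊,w² + B·L±,w²)·‖x⁺ − x‖² + (1 − p)·‖g − ∇f(x)‖². -/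
open Finset MeasureTheory ProbabilityTheory

/-- One step of the PAGE estimator: with `g⁺ = ∇f(x⁺)` with probability `p` and
`g⁺ = g + S(∇f₁(x⁺)−∇f₁(x),…,∇fₙ(x⁺)−∇fₙ(x))` with probability `1−p` (the Bernoulli
variable `c` being independent of the sampling `S`),
`E‖g⁺ − ∇f(x⁺)‖² ≤ (1−p)((A−B)L₊,w² + B L±,w²)‖x⁺−x‖² + (1−p)‖g − ∇f(x)‖²`. -/
theorem page_one_step_variance
    {d n : ℕ} (hn : 0 < n)
    {Ω : Type*} [MeasurableSpace Ω] (μ : Measure Ω) [IsProbabilityMeasure μ]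
    (S : (Fin n → EuclideanSpace ℝ (Fin d)) → Ω → EuclideanSpace ℝ (Fin d))
    (hSmeas : ∀ a, Measurable (S a))
    (hunb : ∀ a : Fin n → EuclideanSpace ℝ (Fin d),
      ∫ ω, S a ω ∂μ = (1 / (n : ℝ)) • ∑ i, a i)
    (A B : ℝ) (hB0 : 0 ≤ B) (hBA : B ≤ A)
    (w : Fin n → ℝ) (hw : ∀ i, 0 < w i) (hw1 : ∑ i, w i = 1)
    (hAB : ∀ a : Fin n → EuclideanSpace ℝ (Fin d),
      ∫ ω, ‖S a ω - (1 / (n : ℝ)) • ∑ i, a i‖ ^ 2 ∂μ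
        ≤ (A / (n : ℝ)) * ∑ i, (1 / ((n : ℝ) * w i)) * ‖a i‖ ^ 2
          - B * ‖(1 / (n : ℝ)) • ∑ i, a i‖ ^ 2)
    (hSint : ∀ a : Fin n → EuclideanSpace ℝ (Fin d),
      Integrable (fun ω => ‖S a ω - (1 / (n : ℝ)) • ∑ i, a i‖ ^ 2) μ)
    (f : EuclideanSpace ℝ (Fin d) → ℝ)
    (fi : Fin n → EuclideanSpace ℝ (Fin d) → ℝ)
    (f' : EuclideanSpace ℝ (Fin d) → EuclideanSpace ℝ (Fin d))
    (fi' : Fin n → EuclideanSpace ℝ (Fin d) → EuclideanSpace ℝ (Fin d))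
    (hf : ∀ x, f x = (1 / (n : ℝ)) * ∑ i, fi i x)
    (hgrad : ∀ x, HasGradientAt f (f' x) x)
    (hgradi : ∀ i x, HasGradientAt (fi i) (fi' i x) x)
    (Lp Lpm : ℝ)
    (hLp : ∀ x y, (1 / (n : ℝ)) * ∑ i, (1 / ((n : ℝ) * w i)) * ‖fi' i x - fi' i y‖ ^ 2
      ≤ Lp ^ 2 * ‖x - y‖ ^ 2)
    (hLpm : ∀ x y, (1 / (n : ℝ)) * ∑ i, (1 / ((n : ℝ) * w i)) * ‖fi' i x - fi' i y‖ ^ 2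
        - ‖f' x - f' y‖ ^ 2 ≤ Lpm ^ 2 * ‖x - y‖ ^ 2)
    (p : ℝ) (hp0 : 0 < p) (hp1 : p ≤ 1)
    (c : Ω → Bool) (hcmeas : Measurable c)
    (hcp : μ {ω | c ω = true} = ENNReal.ofReal p)
    (x xp g : EuclideanSpace ℝ (Fin d))
    (hindep : IndepFun c (S (fun i => fi' i xp - fi' i x)) μ) :
    ∫ ω, ‖(if c ω then f' xp
            else g + S (fun i => fi' i xp - fi' i x) ω) - f' xp‖ ^ 2 ∂μ
      ≤ (1 - p) * ((A - B) * Lp ^ 2 + B * Lpm ^ 2) * ‖xp - x‖ ^ 2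
        + (1 - p) * ‖g - f' x‖ ^ 2 := by
  have hm : ∀ y, f' y = (1 / (n : ℝ)) • ∑ i, fi' i y := by
    intro y
    have h1 : HasFDerivAt f ((1 / (n : ℝ)) • ∑ i, (InnerProductSpace.toDual ℝ _ (fi' i y))) y := by
      have h2 : f = fun x => (1 / (n : ℝ)) • ∑ i, fi i x := by
        funext x
        rw [hf x, smul_eq_mul]
      rw [h2]
      exact (HasFDerivAt.fun_sum fun i _ => (hgradi i y).hasFDerivAt).const_smul (1 / (n : ℝ))
    have h3 := (hgrad y).hasFDerivAt.unique h1
    apply (InnerProductSpace.toDual ℝ (EuclideanSpace ℝ (Fin d))).injective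
    rw [h3]
    simp
  have hm2 : (1 / (n : ℝ)) • ∑ i, (fi' i xp - fi' i x) = f' xp - f' x := by
    rw [hm xp, hm x, Finset.sum_sub_distrib, smul_sub]
  have hI := hSint (fun i => fi' i xp - fi' i x)
  have hE := hunb (fun i => fi' i xp - fi' i x)
  have hV := hAB (fun i => fi' i xp - fi' i x)
  have hM := hSmeas (fun i => fi' i xp - fi' i x)
  simp only [hm2] at hI hE hV
  generalize S (fun i => fi' i xp - fi' i x) = T at *
  have hL2 : MemLp (fun ω => T ω - (f' xp - f' x)) 2 μ :=
    (memLp_two_iff_integrable_sq_norm (hM.sub_const _).aestronglyMeasurable).2 hI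
  have hY : Integrable (fun ω => T ω - (f' xp - f' x)) μ := hL2.integrable (by norm_num)
  have hT : Integrable T μ := by
    have h := hY.add (integrable_const (f' xp - f' x))
    refine h.congr (Filter.Eventually.of_forall fun ω => ?_)
    simp only [Pi.add_apply, sub_add_cancel]
  have hY0 : ∫ ω, (T ω - (f' xp - f' x)) ∂μ = 0 := by
    rw [integral_sub hT (integrable_const _), hE]
    simp
  have hexp : ∫ ω, ‖g + T ω - f' xp‖ ^ 2 ∂μ
      = ‖g - f' x‖ ^ 2 + ∫ ω, ‖T ω - (f' xp - f' x)‖ ^ 2 ∂μ := by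
    have h1 : ∀ ω, ‖g + T ω - f' xp‖ ^ 2 = (‖g - f' x‖ ^ 2
        + 2 * inner ℝ (g - f' x) (T ω - (f' xp - f' x))) + ‖T ω - (f' xp - f' x)‖ ^ 2 := by
      intro ω
      rw [← norm_add_sq_real]
      congr 2
      abel
    have hin : Integrable (fun ω => 2 * inner ℝ (g - f' x) (T ω - (f' xp - f' x))) μ :=
      (hY.const_inner _).const_mul 2
    have hin2 : Integrable (fun ω => ‖g - f' x‖ ^ 2
        + 2 * inner ℝ (g - f' x) (T ω - (f' xp - f' x))) μ := (integrable_const _).add hin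
    simp only [h1]
    rw [integral_add hin2 hI, integral_add (integrable_const _) hin,
      integral_const_mul, integral_inner hY, hY0]
    simp
  have hfac : ∫ ω, ‖(if c ω then f' xp else g + T ω) - f' xp‖ ^ 2 ∂μ
      = (1 - p) * ∫ ω, ‖g + T ω - f' xp‖ ^ 2 ∂μ := by
    have h1 : ∀ ω, ‖(if c ω then f' xp else g + T ω) - f' xp‖ ^ 2
        = (if c ω then (0 : ℝ) else 1) * ‖g + T ω - f' xp‖ ^ 2 := by
      intro ω
      cases c ω <;> simp
    simp only [h1]
    have hφ : Measurable (fun b : Bool => if b then (0 : ℝ) else 1) := measurable_of_finite _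
    have hψ : Measurable (fun t : EuclideanSpace ℝ (Fin d) => ‖g + t - f' xp‖ ^ 2) := by fun_prop
    have h2 := hindep.integral_fun_comp_mul_comp hcmeas.aemeasurable hM.aemeasurable
      hφ.aestronglyMeasurable hψ.aestronglyMeasurable
    rw [h2]
    congr 1
    have hs : MeasurableSet {ω | c ω = true} := hcmeas (measurableSet_singleton true)
    have h3 : ∀ ω, (if c ω then (0 : ℝ) else 1)
        = 1 - Set.indicator {ω | c ω = true} (fun _ => (1 : ℝ)) ω := by
      intro ω
      cases h : c ω <;> simp [Set.indicator, h]
    simp only [h3]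
    rw [integral_sub (integrable_const _) ((integrable_const _).indicator hs),
      integral_indicator_const _ hs]
    simp [Measure.real, hcp, hp0.le]
  rw [hfac, hexp]
  have h1 := hLp xp x
  have h2 := hLpm xp x
  have h3 : A / (n : ℝ) * ∑ i, (1 / ((n : ℝ) * w i)) * ‖fi' i xp - fi' i x‖ ^ 2
      = A * ((1 / (n : ℝ)) * ∑ i, (1 / ((n : ℝ) * w i)) * ‖fi' i xp - fi' i x‖ ^ 2) := by ring
  rw [h3] at hV
  generalize (1 / (n : ℝ)) * ∑ i, (1 / ((n : ℝ) * w i)) * ‖fi' i xp - fi' i x‖ ^ 2 = Q at *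
  have h4 := mul_le_mul_of_nonneg_left h1 (sub_nonneg.2 hBA)
  have h5 := mul_le_mul_of_nonneg_left h2 hB0
  have h6 : ∫ ω, ‖T ω - (f' xp - f' x)‖ ^ 2 ∂μ
      ≤ ((A - B) * Lp ^ 2 + B * Lpm ^ 2) * ‖xp - x‖ ^ 2 := by linarith
  have h7 := mul_le_mul_of_nonneg_left h6 (sub_nonneg.2 hp1)
  linarith
end

section
/- Let f satisfy Assumptions 1–2 and let (x^t), (g^t) be sequences of random vectors in ℝ^d with x^{t+1} = x^t − γ g^t, such that for every t the expected-variance recursion E‖g^{t+1} − ∇f(x^{t+1})‖² ≤ (1 − p)·C·E‖x^{t+1} − x^t‖² + (1 − p)·E‖g^t − ∇f(x^t)‖² holds, where C = (A − B)·L₊,w² + B·L±,w² and p ∈ (0,1]. If γ ≤ (L₋ + √(((1 − p)/p)·C))^{-1}, then defining the Lyapunov function Φ_t = f(x^t) − f* + (γ/(2p))‖g^t − ∇f(x^t)‖², one has E[Φ_{t+1}] ≤ E[Φ_t] − (γ/2)·E‖∇f(x^t)‖² for every t. -/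
open Finset MeasureTheory

lemma page_descent {d : ℕ} (f : EuclideanSpace ℝ (Fin d) → ℝ)
    (f' : EuclideanSpace ℝ (Fin d) → EuclideanSpace ℝ (Fin d)) (L : ℝ)
    (hgrad : ∀ x, HasGradientAt f (f' x) x)
    (hLip : ∀ x y, ‖f' x - f' y‖ ≤ L * ‖x - y‖) (x v : EuclideanSpace ℝ (Fin d)) :
    f (x + v) ≤ f x + inner ℝ (f' x) v + L / 2 * ‖v‖ ^ 2 := by
  have hd : ∀ t : ℝ, HasDerivAt
      (fun t : ℝ => f (x + t • v) - t * inner ℝ (f' x) v - L / 2 * ‖v‖ ^ 2 * t ^ 2)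
      (inner ℝ (f' (x + t • v)) v - inner ℝ (f' x) v - L / 2 * ‖v‖ ^ 2 * (2 * t)) t := by
    intro t
    have h1 : HasDerivAt (fun t : ℝ => x + t • v) v t := by
      simpa using ((hasDerivAt_id t).smul_const v).const_add x
    have h2 := (hgrad (x + t • v)).hasFDerivAt.comp_hasDerivAt t h1
    have h3 := (hasDerivAt_id t).mul_const (inner ℝ (f' x) v)
    have h4 := (hasDerivAt_pow 2 t).const_mul (L / 2 * ‖v‖ ^ 2)
    have h5 := (h2.sub h3).sub h4
    refine HasDerivAt.congr_deriv (f := fun t : ℝ => f (x + t • v) - t * inner ℝ (f' x) v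
      - L / 2 * ‖v‖ ^ 2 * t ^ 2) h5 ?_
    simp
  have hanti := antitoneOn_of_deriv_nonpos (convex_Icc (0 : ℝ) 1)
    (fun t _ => (hd t).continuousAt.continuousWithinAt)
    (fun t _ => (hd t).differentiableAt.differentiableWithinAt)
    (by
      intro t ht
      rw [interior_Icc] at ht
      rw [(hd t).deriv, ← inner_sub_left]
      have h1 := real_inner_le_norm (f' (x + t • v) - f' x) v
      have h2 := hLip (x + t • v) x
      rw [add_sub_cancel_left, norm_smul, Real.norm_of_nonneg ht.1.le] at h2
      have h3 := mul_le_mul_of_nonneg_right h2 (norm_nonneg v)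
      nlinarith)
  have h := hanti (Set.left_mem_Icc.2 zero_le_one) (Set.right_mem_Icc.2 zero_le_one) zero_le_one
  simp at h
  linarith

/-- Lyapunov decrease for PAGE: if `f` is bounded below by `f*`, has `L₋`-Lipschitz gradient,
the iterates satisfy `x^{t+1} = x^t − γ g^t` and the expected-variance recursion
`E‖g^{t+1} − ∇f(x^{t+1})‖² ≤ (1−p) C E‖x^{t+1}−x^t‖² + (1−p) E‖g^t−∇f(x^t)‖²` with
`C = (A−B)L₊,w² + B L±,w²`, and `γ ≤ (L₋ + √(((1−p)/p)C))⁻¹`, then the Lyapunov function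
`Φ_t = f(x^t) − f* + (γ/(2p))‖g^t − ∇f(x^t)‖²` satisfies
`E[Φ_{t+1}] ≤ E[Φ_t] − (γ/2) E‖∇f(x^t)‖²`. -/
theorem page_lyapunov_decrease
    {d : ℕ}
    {Ω : Type*} [MeasurableSpace Ω] (μ : Measure Ω) [IsProbabilityMeasure μ]
    (f : EuclideanSpace ℝ (Fin d) → ℝ)
    (f' : EuclideanSpace ℝ (Fin d) → EuclideanSpace ℝ (Fin d))
    (fstar : ℝ) (hlow : ∀ x, fstar ≤ f x)
    (Lminus : ℝ) (hL0 : 0 ≤ Lminus)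
    (hgrad : ∀ x, HasGradientAt f (f' x) x)
    (hLip : ∀ x y, ‖f' x - f' y‖ ≤ Lminus * ‖x - y‖)
    (A B Lp Lpm : ℝ) (hB0 : 0 ≤ B) (hBA : B ≤ A) (hLp0 : 0 ≤ Lp) (hLpm0 : 0 ≤ Lpm)
    (C : ℝ) (hC : C = (A - B) * Lp ^ 2 + B * Lpm ^ 2)
    (p : ℝ) (hp0 : 0 < p) (hp1 : p ≤ 1)
    (γ : ℝ) (hγ0 : 0 < γ)
    (hγ : γ ≤ (Lminus + Real.sqrt ((1 - p) / p * C))⁻¹)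
    (x g : ℕ → Ω → EuclideanSpace ℝ (Fin d))
    (hupd : ∀ t ω, x (t + 1) ω = x t ω - γ • g t ω)
    (hrec : ∀ t,
      ∫ ω, ‖g (t + 1) ω - f' (x (t + 1) ω)‖ ^ 2 ∂μ
        ≤ (1 - p) * C * ∫ ω, ‖x (t + 1) ω - x t ω‖ ^ 2 ∂μ
          + (1 - p) * ∫ ω, ‖g t ω - f' (x t ω)‖ ^ 2 ∂μ)
    (hint1 : ∀ t, Integrable (fun ω => f (x t ω)) μ)
    (hint2 : ∀ t, Integrable (fun ω => ‖g t ω - f' (x t ω)‖ ^ 2) μ)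
    (hint3 : ∀ t, Integrable (fun ω => ‖f' (x t ω)‖ ^ 2) μ)
    (hint4 : ∀ t, Integrable (fun ω => ‖g t ω‖ ^ 2) μ) :
    ∀ t : ℕ,
      (∫ ω, (f (x (t + 1) ω) - fstar
          + γ / (2 * p) * ‖g (t + 1) ω - f' (x (t + 1) ω)‖ ^ 2) ∂μ)
        ≤ (∫ ω, (f (x t ω) - fstar
              + γ / (2 * p) * ‖g t ω - f' (x t ω)‖ ^ 2) ∂μ)
          - γ / 2 * ∫ ω, ‖f' (x t ω)‖ ^ 2 ∂μ := by
  intro t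
  have hC0 : 0 ≤ C := by
    rw [hC]
    have := sub_nonneg.2 hBA
    positivity
  set s := Real.sqrt ((1 - p) / p * C) with hs
  have hs0 : 0 ≤ s := Real.sqrt_nonneg _
  have hss : s ^ 2 = (1 - p) / p * C :=
    Real.sq_sqrt (mul_nonneg (div_nonneg (by linarith) hp0.le) hC0)
  have hpos : 0 < Lminus + s := inv_pos.1 (hγ0.trans_le hγ)
  have hle : γ * (Lminus + s) ≤ 1 := by
    have := mul_le_mul_of_nonneg_right hγ hpos.le
    rwa [inv_mul_cancel₀ hpos.ne'] at this
  have hpt : ∀ ω, f (x (t + 1) ω) ≤ f (x t ω) + (-(γ / 2)) * ‖f' (x t ω)‖ ^ 2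
      + (γ / 2 * (Lminus * γ - 1)) * ‖g t ω‖ ^ 2
      + γ / 2 * ‖g t ω - f' (x t ω)‖ ^ 2 := by
    intro ω
    have h := page_descent f f' Lminus hgrad hLip (x t ω) (-(γ • g t ω))
    rw [← sub_eq_add_neg, ← hupd, inner_neg_right, inner_smul_right, norm_neg, norm_smul,
      Real.norm_of_nonneg hγ0.le] at h
    have h2 := norm_sub_sq_real (g t ω) (f' (x t ω))
    rw [real_inner_comm] at h2
    rw [h2]
    linarith
  have hi1 := hint1 t
  have hi2 := (hint3 t).const_mul (-(γ / 2))
  have hi3 := (hint4 t).const_mul (γ / 2 * (Lminus * γ - 1))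
  have hi4 := (hint2 t).const_mul (γ / 2)
  have hF := integral_mono (hint1 (t + 1)) (((hi1.add hi2).add hi3).add hi4) hpt
  have hE : ∫ ω, (f (x t ω) + (-(γ / 2)) * ‖f' (x t ω)‖ ^ 2
      + (γ / 2 * (Lminus * γ - 1)) * ‖g t ω‖ ^ 2
      + γ / 2 * ‖g t ω - f' (x t ω)‖ ^ 2) ∂μ
      = ∫ ω, f (x t ω) ∂μ + (-(γ / 2)) * ∫ ω, ‖f' (x t ω)‖ ^ 2 ∂μ
      + (γ / 2 * (Lminus * γ - 1)) * ∫ ω, ‖g t ω‖ ^ 2 ∂μ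
      + γ / 2 * ∫ ω, ‖g t ω - f' (x t ω)‖ ^ 2 ∂μ := by
    rw [integral_add (by exact (hi1.add hi2).add hi3) hi4,
      integral_add (by exact hi1.add hi2) hi3,
      integral_add hi1 hi2]
    simp only [integral_const_mul]
  have hF2 := hF.trans_eq hE
  have hPhi : ∀ k, ∫ ω, (f (x k ω) - fstar + γ / (2 * p) * ‖g k ω - f' (x k ω)‖ ^ 2) ∂μ
      = ∫ ω, f (x k ω) ∂μ - fstar + γ / (2 * p) * ∫ ω, ‖g k ω - f' (x k ω)‖ ^ 2 ∂μ := by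
    intro k
    rw [integral_add (by exact (hint1 k).sub (integrable_const fstar)) ((hint2 k).const_mul _),
      integral_sub (hint1 k) (integrable_const fstar), integral_const_mul]
    simp
  have hstep : ∫ ω, ‖x (t + 1) ω - x t ω‖ ^ 2 ∂μ = γ ^ 2 * ∫ ω, ‖g t ω‖ ^ 2 ∂μ := by
    rw [← integral_const_mul]
    congr 1
    funext ω
    rw [hupd, sub_sub_cancel_left, norm_neg, norm_smul, Real.norm_of_nonneg hγ0.le, mul_pow]
  have hr := hrec t
  rw [hstep] at hr
  rw [hPhi, hPhi]
  have hG : 0 ≤ ∫ ω, ‖g t ω‖ ^ 2 ∂μ := integral_nonneg fun ω => by positivity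
  generalize (∫ ω, ‖g t ω‖ ^ 2 ∂μ) = G at *
  generalize (∫ ω, ‖g t ω - f' (x t ω)‖ ^ 2 ∂μ) = V at *
  generalize (∫ ω, ‖g (t + 1) ω - f' (x (t + 1) ω)‖ ^ 2 ∂μ) = V1 at *
  have hr2 := mul_le_mul_of_nonneg_left hr (by positivity : 0 ≤ γ / (2 * p))
  have e : γ / (2 * p) * ((1 - p) * C * (γ ^ 2 * G) + (1 - p) * V)
      = γ / 2 * (s ^ 2 * γ ^ 2) * G + γ / (2 * p) * V - γ / 2 * V := by
    rw [hss]
    field_simp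
    ring
  have hk : Lminus * γ - 1 + s ^ 2 * γ ^ 2 ≤ 0 := by
    have a1 : 0 ≤ γ * s := by positivity
    have a2 : 0 ≤ γ * Lminus := by positivity
    nlinarith
  have hfin := mul_nonneg (mul_nonneg (by positivity : 0 ≤ γ / 2) hG) (neg_nonneg.2 hk)
  rw [e] at hr2
  linarith
end

section
/- (Variance of a composition of samplings.) Let S be a sampling on n arguments satisfying the weighted AB inequality with constants A, B and weights (w_1,…,w_n), with B ≤ 1, and for each i ∈ [n] let S_i be a sampling on m_i arguments satisfying the weighted AB inequality with constants A_i, B_i and weights (w_{i1},…,w_{i m_i}); assume S, S_1, …, S_n are mutually independent. Then for all vectors a_{ij} ∈ ℝ^d (j ∈ [m_i], i ∈ [n]), writing a_i = (1/m_i)∑_{j=1}^{m_i} a_{ij} and ā = (1/n)∑_{i=1}^n a_i: E‖S(S_1(a_{11},…,a_{1m_1}), …, S_n(a_{n1},…,a_{nm_n})) − ā‖² ≤ (1/n)∑_{i=1}^n (A/(n w_i) + (1 − B)/n)·( (A_i/m_i)∑_{j=1}^{m_i} (1/(m_i w_{ij}))‖a_{ij}‖² − B_i‖a_i‖² ) +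 (A/n)∑_{i=1}^n (1/(n w_i))‖a_i‖² − B‖ā‖². -/
open Finset MeasureTheory

/-- Square integrability of a measurable map from that of its centred version. -/
lemma aux_memLp {d : ℕ} {Ω : Type*} [MeasurableSpace Ω] (μ : Measure Ω) [IsProbabilityMeasure μ]
    (Y : Ω → EuclideanSpace ℝ (Fin d)) (hY : AEStronglyMeasurable Y μ)
    (c : EuclideanSpace ℝ (Fin d)) (hi : Integrable (fun ω => ‖Y ω - c‖ ^ 2) μ) :
    MemLp Y 2 μ := by
  have h1 : MemLp (fun ω => Y ω - c) 2 μ :=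
    (memLp_two_iff_integrable_sq_norm (hY.sub aestronglyMeasurable_const)).2 hi
  have h2 := h1.add (memLp_const (μ := μ) (p := 2) c)
  refine h2.ae_eq (Filter.Eventually.of_forall fun ω => ?_)
  simp

/-- Bias-variance decomposition. -/
lemma aux_bias {d : ℕ} {Ω : Type*} [MeasurableSpace Ω] (μ : Measure Ω) [IsProbabilityMeasure μ]
    (Y : Ω → EuclideanSpace ℝ (Fin d)) (hY : MemLp Y 2 μ)
    (c v : EuclideanSpace ℝ (Fin d)) (hc : ∫ ω, Y ω ∂μ = c) :
    ∫ ω, ‖Y ω - v‖ ^ 2 ∂μ = ∫ ω, ‖Y ω - c‖ ^ 2 ∂μ + ‖c - v‖ ^ 2 := by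
  have hYi : Integrable Y μ := hY.integrable (by norm_num)
  have hD : MemLp (fun ω => Y ω - c) 2 μ := hY.sub (memLp_const c)
  have hDi : Integrable (fun ω => Y ω - c) μ := hYi.sub (integrable_const c)
  have hsq : Integrable (fun ω => ‖Y ω - c‖ ^ 2) μ :=
    (memLp_two_iff_integrable_sq_norm hD.1).1 hD
  have hin : Integrable (fun ω => 2 * inner ℝ (c - v) (Y ω - c)) μ :=
    (hDi.const_inner (c - v)).const_mul 2
  have e : ∀ ω, ‖Y ω - v‖ ^ 2
      = ‖Y ω - c‖ ^ 2 + 2 * inner ℝ (c - v) (Y ω - c) + ‖c - v‖ ^ 2 := by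
    intro ω
    have : Y ω - v = (Y ω - c) + (c - v) := by abel
    rw [this, norm_add_sq_real, real_inner_comm]
  have h0 : ∫ ω, (Y ω - c) ∂μ = 0 := by
    rw [integral_sub hYi (integrable_const c), hc]; simp
  have hadd : Integrable (fun ω => ‖Y ω - c‖ ^ 2 + 2 * inner ℝ (c - v) (Y ω - c)) μ :=
    hsq.add hin
  simp_rw [e]
  rw [integral_add hadd (integrable_const _), integral_add hsq hin, integral_const_mul,
    integral_inner hDi, h0]
  simp

/-- Variance of a sum of independent centred vectors. -/
lemma aux_sum {d n : ℕ} {Ωl : Fin n → Type} [∀ i, MeasurableSpace (Ωl i)]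
    (μl : ∀ i, Measure (Ωl i)) [∀ i, IsProbabilityMeasure (μl i)]
    (D : ∀ i, Ωl i → EuclideanSpace ℝ (Fin d)) (hD : ∀ i, MemLp (D i) 2 (μl i))
    (h0 : ∀ i, ∫ ω, D i ω ∂(μl i) = 0) :
    ∫ ω : ∀ i, Ωl i, ‖∑ i, D i (ω i)‖ ^ 2 ∂(Measure.pi μl)
      = ∑ i, ∫ ω, ‖D i ω‖ ^ 2 ∂(μl i) := by
  have hL : ∀ i, MemLp (fun ω : ∀ i, Ωl i => D i (ω i)) 2 (Measure.pi μl) := fun i =>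
    (hD i).comp_measurePreserving (measurePreserving_eval μl i)
  have hLi : ∀ i, Integrable (fun ω : ∀ i, Ωl i => D i (ω i)) (Measure.pi μl) := fun i =>
    (hL i).integrable (by norm_num)
  have hinn : ∀ i j, Integrable (fun ω : ∀ i, Ωl i => inner ℝ (D i (ω i)) (D j (ω j)))
      (Measure.pi μl) := by
    intro i j
    refine ((hL i).norm.integrable_mul (hL j).norm).mono
      ((hL i).1.inner (hL j).1) (Filter.Eventually.of_forall fun ω => ?_)
    simpa using abs_real_inner_le_norm (D i (ω i)) (D j (ω j))
  have hI := ProbabilityTheory.iIndepFun_pi (μ := μl) (X := D) (fun i => (hD i).1.aemeasurable)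
  have hz : ∀ i, ∫ ω : ∀ i, Ωl i, D i (ω i) ∂(Measure.pi μl) = 0 := by
    intro i
    rw [integral_comp_eval (μ := μl) (f := D i) (hD i).1, h0 i]
  have hcross : ∀ i j, i ≠ j →
      ∫ ω : ∀ i, Ωl i, inner ℝ (D i (ω i)) (D j (ω j)) ∂(Measure.pi μl) = 0 := by
    intro i j hij
    have := (hI.indepFun hij).integral_bilin (hLi i) (hLi j) (innerSL ℝ)
    refine this.trans ?_
    rw [hz i, map_zero]
    rfl
  have e : ∀ ω : ∀ i, Ωl i, ‖∑ i, D i (ω i)‖ ^ 2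
      = ∑ i, ∑ j, inner ℝ (D i (ω i)) (D j (ω j)) := by
    intro ω
    rw [← real_inner_self_eq_norm_sq, sum_inner]
    simp_rw [inner_sum]
  simp_rw [e]
  rw [integral_finsetSum _ (fun i _ => integrable_finsetSum _ fun j _ => hinn i j)]
  refine Finset.sum_congr rfl fun i _ => ?_
  rw [integral_finsetSum _ (fun j _ => hinn i j), Finset.sum_eq_single i]
  · simp_rw [real_inner_self_eq_norm_sq]
    exact integral_comp_eval (μ := μl) (f := fun ω => ‖D i ω‖ ^ 2) ((hD i).1.norm.pow 2)
  · intro j _ hj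
    exact hcross i j hj.symm
  · simp



/-- Variance of a composition of samplings (Lemma 2).  The outer sampling `S` (on `n`
arguments, with constants `A, B`, `B ≤ 1`, and weights `w`) and the inner samplings `Sl i`
(on `m i` arguments, with constants `Al i, Bl i` and weights `wl i`) live on independent
probability spaces `Ω0` and `Ωl i` (mutual independence is modeled by taking the product
measure), and each satisfies the weighted AB inequality.  Then the composed estimator
`S(S₁(a₁₁,…),…,Sₙ(aₙ₁,…))` satisfies the stated variance bound. -/
theorem composition_sampling_variance
    {d n : ℕ} (hn : 0 < n) (m : Fin n → ℕ) (hm : ∀ i, 0 < m i)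
    {Ω0 : Type} [MeasurableSpace Ω0] (μ0 : Measure Ω0) [IsProbabilityMeasure μ0]
    {Ωl : Fin n → Type} [∀ i, MeasurableSpace (Ωl i)]
    (μl : ∀ i, Measure (Ωl i)) [∀ i, IsProbabilityMeasure (μl i)]
    (S : (Fin n → EuclideanSpace ℝ (Fin d)) → Ω0 → EuclideanSpace ℝ (Fin d))
    (Sl : ∀ i, (Fin (m i) → EuclideanSpace ℝ (Fin d)) → Ωl i → EuclideanSpace ℝ (Fin d))
    (A B : ℝ) (hA0 : 0 ≤ A) (hB0 : 0 ≤ B) (hB1 : B ≤ 1)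
    (w : Fin n → ℝ) (hw : ∀ i, 0 < w i) (hw1 : ∑ i, w i = 1)
    (Al Bl : Fin n → ℝ) (hAl0 : ∀ i, 0 ≤ Al i) (hBl0 : ∀ i, 0 ≤ Bl i)
    (wl : ∀ i, Fin (m i) → ℝ) (hwl : ∀ i j, 0 < wl i j) (hwl1 : ∀ i, ∑ j, wl i j = 1)
    (hSmeas : ∀ b, Measurable (S b))
    (hunb : ∀ b : Fin n → EuclideanSpace ℝ (Fin d),
      ∫ ω, S b ω ∂μ0 = (1 / (n : ℝ)) • ∑ i, b i)
    (hAB : ∀ b : Fin n → EuclideanSpace ℝ (Fin d),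
      ∫ ω, ‖S b ω - (1 / (n : ℝ)) • ∑ i, b i‖ ^ 2 ∂μ0
        ≤ (A / (n : ℝ)) * ∑ i, (1 / ((n : ℝ) * w i)) * ‖b i‖ ^ 2
          - B * ‖(1 / (n : ℝ)) • ∑ i, b i‖ ^ 2)
    (hSint : ∀ b : Fin n → EuclideanSpace ℝ (Fin d),
      Integrable (fun ω => ‖S b ω - (1 / (n : ℝ)) • ∑ i, b i‖ ^ 2) μ0)
    (hSlmeas : ∀ i b, Measurable (Sl i b))
    (hunbl : ∀ i, ∀ b : Fin (m i) → EuclideanSpace ℝ (Fin d),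
      ∫ ω, Sl i b ω ∂(μl i) = (1 / (m i : ℝ)) • ∑ j, b j)
    (hABl : ∀ i, ∀ b : Fin (m i) → EuclideanSpace ℝ (Fin d),
      ∫ ω, ‖Sl i b ω - (1 / (m i : ℝ)) • ∑ j, b j‖ ^ 2 ∂(μl i)
        ≤ (Al i / (m i : ℝ)) * ∑ j, (1 / ((m i : ℝ) * wl i j)) * ‖b j‖ ^ 2
          - Bl i * ‖(1 / (m i : ℝ)) • ∑ j, b j‖ ^ 2)
    (hSlint : ∀ i, ∀ b : Fin (m i) → EuclideanSpace ℝ (Fin d),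
      Integrable (fun ω => ‖Sl i b ω - (1 / (m i : ℝ)) • ∑ j, b j‖ ^ 2) (μl i))
    (a : ∀ i, Fin (m i) → EuclideanSpace ℝ (Fin d))
    (hmeas : AEStronglyMeasurable
      (fun ω : Ω0 × (∀ i, Ωl i) => S (fun i => Sl i (a i) (ω.2 i)) ω.1)
      (μ0.prod (Measure.pi μl)))
    (hint : Integrable
      (fun ω : Ω0 × (∀ i, Ωl i) =>
        ‖S (fun i => Sl i (a i) (ω.2 i)) ω.1
            - (1 / (n : ℝ)) • ∑ i, (1 / (m i : ℝ)) • ∑ j, a i j‖ ^ 2)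
      (μ0.prod (Measure.pi μl))) :
    ∫ ω : Ω0 × (∀ i, Ωl i),
        ‖S (fun i => Sl i (a i) (ω.2 i)) ω.1
            - (1 / (n : ℝ)) • ∑ i, (1 / (m i : ℝ)) • ∑ j, a i j‖ ^ 2
        ∂(μ0.prod (Measure.pi μl))
      ≤ (1 / (n : ℝ)) * ∑ i, (A / ((n : ℝ) * w i) + (1 - B) / (n : ℝ))
            * ((Al i / (m i : ℝ)) * ∑ j, (1 / ((m i : ℝ) * wl i j)) * ‖a i j‖ ^ 2
                - Bl i * ‖(1 / (m i : ℝ)) • ∑ j, a i j‖ ^ 2)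
        + (A / (n : ℝ)) * ∑ i, (1 / ((n : ℝ) * w i)) * ‖(1 / (m i : ℝ)) • ∑ j, a i j‖ ^ 2
        - B * ‖(1 / (n : ℝ)) • ∑ i, (1 / (m i : ℝ)) • ∑ j, a i j‖ ^ 2 := by
  classical
  have hn' : (0 : ℝ) < n := by exact_mod_cast hn
  set c : Fin n → EuclideanSpace ℝ (Fin d) := fun i => (1 / (m i : ℝ)) • ∑ j, a i j with hc
  set cb : EuclideanSpace ℝ (Fin d) := (1 / (n : ℝ)) • ∑ i, c i with hcb
  set P := Measure.pi μl with hP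
  set X : (∀ i, Ωl i) → Fin n → EuclideanSpace ℝ (Fin d) :=
    fun ω i => Sl i (a i) (ω i) with hX
  set M : (∀ i, Ωl i) → EuclideanSpace ℝ (Fin d) := fun ω => (1 / (n : ℝ)) • ∑ i, X ω i with hM
  set V : Fin n → ℝ := fun i => ∫ ω, ‖Sl i (a i) ω - c i‖ ^ 2 ∂(μl i) with hV
  -- inner samplings
  have hY : ∀ i, MemLp (Sl i (a i)) 2 (μl i) := fun i =>
    aux_memLp (μl i) _ (hSlmeas i (a i)).aestronglyMeasurable (c i) (hSlint i (a i))
  have hXL : ∀ i, MemLp (fun ω => X ω i) 2 P := fun i =>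
    (hY i).comp_measurePreserving (measurePreserving_eval μl i)
  have hML : MemLp M 2 P := (memLp_finsetSum Finset.univ fun i _ => hXL i).const_smul (1 / (n : ℝ))
  have hXm : ∀ i, ∫ ω, X ω i ∂P = c i := by
    intro i
    refine Eq.trans ?_ (hunbl i (a i))
    exact integral_comp_eval (μ := μl) (f := Sl i (a i)) (hY i).1
  have hMm : ∫ ω, M ω ∂P = cb := by
    simp only [hM]
    rw [integral_smul, integral_finsetSum _ (fun i _ => (hXL i).integrable (by norm_num))]
    simp_rw [hXm]
    rfl
  have hXsq : ∀ i, ∫ ω, ‖X ω i‖ ^ 2 ∂P = V i + ‖c i‖ ^ 2 := by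
    intro i
    have h1 := aux_bias (μl i) (Sl i (a i)) (hY i) (c i) 0 (hunbl i (a i))
    simp only [sub_zero] at h1
    rw [← h1]
    exact integral_comp_eval (μ := μl) (f := fun ω => ‖Sl i (a i) ω‖ ^ 2) ((hY i).1.norm.pow 2)
  have hMvar : ∫ ω, ‖M ω - cb‖ ^ 2 ∂P = (1 / (n : ℝ)) ^ 2 * ∑ i, V i := by
    have h1 := aux_sum μl (fun i ω => Sl i (a i) ω - c i)
      (fun i => (hY i).sub (memLp_const (c i))) (fun i => by
        rw [integral_sub ((hY i).integrable (by norm_num)) (integrable_const _), hunbl]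
        simp [hc])
    have h2 : ∀ ω, ‖M ω - cb‖ ^ 2
        = (1 / (n : ℝ)) ^ 2 * ‖∑ i, (Sl i (a i) (ω i) - c i)‖ ^ 2 := by
      intro ω
      rw [hM, hcb]
      simp only
      rw [← smul_sub, ← Finset.sum_sub_distrib, norm_smul, mul_pow, Real.norm_eq_abs, sq_abs]
    simp_rw [h2]
    rw [integral_const_mul, h1]
  have hMsq : ∫ ω, ‖M ω‖ ^ 2 ∂P = (1 / (n : ℝ)) ^ 2 * ∑ i, V i + ‖cb‖ ^ 2 := by
    have h1 := aux_bias P M hML cb 0 hMm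
    simp only [sub_zero] at h1
    rw [h1, hMvar]
  -- outer sampling
  have hout : ∀ ω, ∫ ω0, ‖S (X ω) ω0 - cb‖ ^ 2 ∂μ0
      ≤ ((A / (n : ℝ)) * ∑ i, (1 / ((n : ℝ) * w i)) * ‖X ω i‖ ^ 2 - B * ‖M ω‖ ^ 2)
        + ‖M ω - cb‖ ^ 2 := by
    intro ω
    rw [aux_bias μ0 (S (X ω)) (aux_memLp μ0 _ (hSmeas _).aestronglyMeasurable _ (hSint (X ω)))
      (M ω) cb (hunb (X ω))]
    exact add_le_add_left (hAB (X ω)) _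
  have iX : ∀ i, Integrable (fun ω => ‖X ω i‖ ^ 2) P := fun i =>
    (memLp_two_iff_integrable_sq_norm (hXL i).1).1 (hXL i)
  have iM : Integrable (fun ω => ‖M ω‖ ^ 2) P := (memLp_two_iff_integrable_sq_norm hML.1).1 hML
  have iMc : Integrable (fun ω => ‖M ω - cb‖ ^ 2) P := by
    have h := hML.sub (memLp_const (μ := P) (p := 2) cb)
    exact (memLp_two_iff_integrable_sq_norm h.1).1 h
  have iS : Integrable (fun ω => ∑ i, (1 / ((n : ℝ) * w i)) * ‖X ω i‖ ^ 2) P :=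
    integrable_finsetSum _ fun i _ => (iX i).const_mul _
  have iAB : Integrable (fun ω => (A / (n : ℝ)) * ∑ i, (1 / ((n : ℝ) * w i)) * ‖X ω i‖ ^ 2
      - B * ‖M ω‖ ^ 2) P := (iS.const_mul _).sub (iM.const_mul _)
  have hrhs : ∫ ω, (((A / (n : ℝ)) * ∑ i, (1 / ((n : ℝ) * w i)) * ‖X ω i‖ ^ 2 - B * ‖M ω‖ ^ 2)
        + ‖M ω - cb‖ ^ 2) ∂P
      = (A / (n : ℝ)) * ∑ i, (1 / ((n : ℝ) * w i)) * (V i + ‖c i‖ ^ 2)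
        - B * ((1 / (n : ℝ)) ^ 2 * ∑ i, V i + ‖cb‖ ^ 2) + (1 / (n : ℝ)) ^ 2 * ∑ i, V i := by
    rw [integral_add iAB iMc, integral_sub (iS.const_mul _) (iM.const_mul _), integral_const_mul,
      integral_const_mul, hMsq, hMvar, integral_finsetSum _ (fun i _ => (iX i).const_mul _)]
    simp_rw [integral_const_mul, hXsq]
  have hfub : ∫ ω : Ω0 × (∀ i, Ωl i), ‖S (X ω.2) ω.1 - cb‖ ^ 2 ∂(μ0.prod P)
      = ∫ ω, ∫ ω0, ‖S (X ω) ω0 - cb‖ ^ 2 ∂μ0 ∂P :=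
    integral_prod_symm _ hint
  have hmain : ∫ ω : Ω0 × (∀ i, Ωl i), ‖S (X ω.2) ω.1 - cb‖ ^ 2 ∂(μ0.prod P)
      ≤ (A / (n : ℝ)) * ∑ i, (1 / ((n : ℝ) * w i)) * (V i + ‖c i‖ ^ 2)
        - B * ((1 / (n : ℝ)) ^ 2 * ∑ i, V i + ‖cb‖ ^ 2) + (1 / (n : ℝ)) ^ 2 * ∑ i, V i := by
    rw [hfub, ← hrhs]
    exact integral_mono hint.integral_prod_right (iAB.add iMc) hout
  refine hmain.trans ?_
  have hVle : ∑ i, (A / ((n : ℝ) * w i) + (1 - B) / (n : ℝ)) * V i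
      ≤ ∑ i, (A / ((n : ℝ) * w i) + (1 - B) / (n : ℝ))
            * ((Al i / (m i : ℝ)) * ∑ j, (1 / ((m i : ℝ) * wl i j)) * ‖a i j‖ ^ 2
                - Bl i * ‖c i‖ ^ 2) := by
    refine Finset.sum_le_sum fun i _ => mul_le_mul_of_nonneg_left (hABl i (a i)) ?_
    have := hw i
    have : 0 ≤ 1 - B := by linarith
    positivity
  have hid : (A / (n : ℝ)) * ∑ i, (1 / ((n : ℝ) * w i)) * (V i + ‖c i‖ ^ 2)
        - B * ((1 / (n : ℝ)) ^ 2 * ∑ i, V i + ‖cb‖ ^ 2) + (1 / (n : ℝ)) ^ 2 * ∑ i, V i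
      = (1 / (n : ℝ)) * ∑ i, (A / ((n : ℝ) * w i) + (1 - B) / (n : ℝ)) * V i
        + (A / (n : ℝ)) * ∑ i, (1 / ((n : ℝ) * w i)) * ‖c i‖ ^ 2 - B * ‖cb‖ ^ 2 := by
    have e1 : ∑ i, (1 / ((n : ℝ) * w i)) * (V i + ‖c i‖ ^ 2)
        = ∑ i, (1 / ((n : ℝ) * w i)) * V i + ∑ i, (1 / ((n : ℝ) * w i)) * ‖c i‖ ^ 2 := by
      rw [← Finset.sum_add_distrib]
      exact Finset.sum_congr rfl fun i _ => by ring
    have e2 : ∑ i, (A / ((n : ℝ) * w i) + (1 - B) / (n : ℝ)) * V i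
        = A * ∑ i, (1 / ((n : ℝ) * w i)) * V i + (1 - B) / (n : ℝ) * ∑ i, V i := by
      rw [Finset.mul_sum, Finset.mul_sum, ← Finset.sum_add_distrib]
      exact Finset.sum_congr rfl fun i _ => by ring
    rw [e1, e2]
    ring
  rw [hid]
  have h1 := mul_le_mul_of_nonneg_left hVle (show (0 : ℝ) ≤ 1 / (n : ℝ) by positivity)
  linarith
end

section
/- (Variance of the Extended Nice sampling.) Let l_1,…,l_n be positive integers, N = ∑_{j=1}^n l_j ≥ 2, and 1 ≤ τ ≤ N. Form the list ã_1,…,ã_N ∈ ℝ^d in which the vector (N/(n l_i))·a_i appears exactly l_i times for each i ∈ {1,…,n}, and let S be a uniformly random τ-element subset of {1,…,N}. Then for all a_1,…,a_n ∈ ℝ^d, the estimator (1/τ)∑_{j∈S} ã_j is unbiased for ā = (1/n)∑_{i=1}^n a_i and satisfies the exact identity E‖(1/τ)∑_{j∈S} ã_j − ā‖² = ((N − τ)/(τ(N − 1)))·( ∑_{i=1}^n (1/(n² w_i))‖a_i‖² − ‖ā‖² ), where w_i = l_i/N. In particular the Extended Nice sampling satisfies the weighted AB inequality with A = B = (N −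 τ)/(τ(N − 1)) and weights w_i = l_i/N. -/
open Finset

/-- Number of `τ`-subsets containing a given point. -/
lemma ens_count_one {N τ : ℕ} (hN2 : 2 ≤ N) (hτ1 : 1 ≤ τ) (i : Fin N) :
    (((powersetCard τ (univ : Finset (Fin N))).filter (fun s => i ∈ s)).card : ℝ)
      = (N.choose τ : ℝ) * ((τ : ℝ) / N) := by
  have h := card_filter_powersetCard_subset {i} (univ : Finset (Fin N)) τ (subset_univ _)
    (by simpa using hτ1)
  simp only [singleton_subset_iff, card_univ, Fintype.card_fin, card_singleton] at h
  rw [h]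
  obtain ⟨M, rfl⟩ : ∃ M, N = M + 1 := ⟨N - 1, by omega⟩
  obtain ⟨t, rfl⟩ : ∃ t, τ = t + 1 := ⟨τ - 1, by omega⟩
  have h2 : ((M + 1 : ℕ) : ℝ) * (M.choose t : ℝ)
      = ((M + 1).choose (t + 1) : ℝ) * ((t + 1 : ℕ) : ℝ) := by
    exact_mod_cast Nat.add_one_mul_choose_eq M t
  have : ((M + 1 : ℕ) : ℝ) ≠ 0 := by positivity
  simp only [Nat.add_sub_cancel]
  field_simp
  linarith

/-- Number of `τ`-subsets containing two given distinct points. -/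
lemma ens_count_two {N τ : ℕ} (hN2 : 2 ≤ N) (hτ1 : 1 ≤ τ) (i j : Fin N) (hij : i ≠ j) :
    (((powersetCard τ (univ : Finset (Fin N))).filter (fun s => i ∈ s ∧ j ∈ s)).card : ℝ)
      = (N.choose τ : ℝ) * (((τ : ℝ) * (τ - 1)) / (N * (N - 1))) := by
  obtain rfl | hτ2 : τ = 1 ∨ 2 ≤ τ := by omega
  · have : (powersetCard 1 (univ : Finset (Fin N))).filter (fun s => i ∈ s ∧ j ∈ s) = ∅ := by
      refine filter_eq_empty_iff.2 ?_
      rintro s hs ⟨h1, h2⟩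
      obtain ⟨x, rfl⟩ := card_eq_one.1 (mem_powersetCard.1 hs).2
      rw [mem_singleton] at h1 h2
      exact hij (h1.trans h2.symm)
    rw [this]
    simp
  have h := card_filter_powersetCard_subset {i, j} (univ : Finset (Fin N)) τ (subset_univ _)
    (by rw [card_pair hij]; exact hτ2)
  simp only [insert_subset_iff, singleton_subset_iff, card_univ, Fintype.card_fin,
    card_pair hij] at h
  rw [h]
  obtain ⟨M, rfl⟩ : ∃ M, N = M + 2 := ⟨N - 2, by omega⟩
  obtain ⟨t, rfl⟩ : ∃ t, τ = t + 2 := ⟨τ - 2, by omega⟩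
  have h1 : ((M : ℝ) + 1) * (M.choose t : ℝ) = ((M + 1).choose (t + 1) : ℝ) * ((t : ℝ) + 1) := by
    exact_mod_cast Nat.add_one_mul_choose_eq M t
  have h2 : ((M : ℝ) + 2) * ((M + 1).choose (t + 1) : ℝ)
      = ((M + 2).choose (t + 2) : ℝ) * ((t : ℝ) + 2) := by
    exact_mod_cast Nat.add_one_mul_choose_eq (M + 1) (t + 1)
  have e1 : ((M : ℝ) + 2 - 1) = M + 1 := by ring
  have e2 : ((t : ℝ) + 2 - 1) = t + 1 := by ring
  have p1 : (M : ℝ) + 1 ≠ 0 := by positivity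
  have p2 : (M : ℝ) + 2 ≠ 0 := by positivity
  simp only [Nat.add_sub_cancel]
  push_cast
  rw [e1, e2]
  field_simp
  linear_combination ((M : ℝ) + 2) * h1 + ((t : ℝ) + 1) * h2

/-- First moment. -/
lemma ens_sum_one {N τ : ℕ} {E : Type*} [AddCommGroup E] [Module ℝ E]
    (hN2 : 2 ≤ N) (hτ1 : 1 ≤ τ) (b : Fin N → E) :
    ∑ s ∈ powersetCard τ (univ : Finset (Fin N)), ∑ j ∈ s, b j
      = ((N.choose τ : ℝ) * ((τ : ℝ) / N)) • ∑ j, b j := by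
  have : ∀ s : Finset (Fin N), ∑ j ∈ s, b j = ∑ j, if j ∈ s then b j else 0 := by
    intro s; simp
  simp_rw [this]
  rw [sum_comm, smul_sum]
  refine sum_congr rfl fun j _ => ?_
  rw [← sum_filter, sum_const, ← ens_count_one hN2 hτ1 j, Nat.cast_smul_eq_nsmul]
  simp

/-- Second moment of a centred family. -/
lemma ens_sum_two {N τ : ℕ} {E : Type*} [NormedAddCommGroup E] [InnerProductSpace ℝ E]
    (hN2 : 2 ≤ N) (hτ1 : 1 ≤ τ) (c : Fin N → E) (hc : ∑ j, c j = 0) :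
    ∑ s ∈ powersetCard τ (univ : Finset (Fin N)), ‖∑ j ∈ s, c j‖ ^ 2
      = (N.choose τ : ℝ) * ((τ : ℝ) / N) * (((N : ℝ) - τ) / (N - 1)) * ∑ j, ‖c j‖ ^ 2 := by
  have h1 : ∀ s : Finset (Fin N), ‖∑ j ∈ s, c j‖ ^ 2
      = ∑ i, ∑ j, if i ∈ s ∧ j ∈ s then inner ℝ (c i) (c j) else 0 := by
    intro s
    rw [← real_inner_self_eq_norm_sq, sum_inner]
    simp_rw [inner_sum, ite_and]
    simp
  simp_rw [h1]
  rw [sum_comm]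
  set P : ℝ := (N.choose τ : ℝ) * ((τ : ℝ) / N) with hP
  set Q : ℝ := (N.choose τ : ℝ) * (((τ : ℝ) * (τ - 1)) / (N * (N - 1))) with hQ
  rw [mul_sum]
  refine sum_congr rfl fun i _ => ?_
  rw [sum_comm]
  have h2 : ∀ j, (∑ s ∈ powersetCard τ (univ : Finset (Fin N)),
      if i ∈ s ∧ j ∈ s then inner ℝ (c i) (c j) else (0 : ℝ))
      = Q * inner ℝ (c i) (c j) + if i = j then (P - Q) * ‖c i‖ ^ 2 else 0 := by
    intro j
    rw [← sum_filter, sum_const, nsmul_eq_mul]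
    by_cases hij : i = j
    · subst hij
      simp only [and_self, if_true]
      rw [ens_count_one hN2 hτ1 i, real_inner_self_eq_norm_sq]
      ring
    · rw [ens_count_two hN2 hτ1 i j hij, if_neg hij]
      ring
  simp_rw [h2]
  rw [sum_add_distrib, ← mul_sum, ← inner_sum, hc]
  have hN : (2 : ℝ) ≤ N := by exact_mod_cast hN2
  have q1 : (N : ℝ) ≠ 0 := by positivity
  have q2 : (N : ℝ) - 1 ≠ 0 := by linarith
  have : P - Q = P * (((N : ℝ) - τ) / (N - 1)) := by
    rw [hP, hQ]
    field_simp
    ring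
  simp [this]

/-- Variance of the Extended Nice sampling: each `aᵢ` is repeated `lᵢ` times (rescaled to
`(N/(n lᵢ)) aᵢ`, where `N = ∑ lᵢ`; the repetition is encoded by a map `idx : Fin N → Fin n`
whose fiber over `i` has exactly `lᵢ` elements), and a uniformly random `τ`-element subset
of the `N` copies is averaged.  The estimator is unbiased for `ā = (1/n)∑ᵢ aᵢ` and
`E‖·−ā‖² = ((N−τ)/(τ(N−1)))(∑ᵢ(1/(n² wᵢ))‖aᵢ‖² − ‖ā‖²)` with `wᵢ = lᵢ/N`; in particular the
Extended Nice sampling satisfies the weighted AB inequality with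
`A = B = (N−τ)/(τ(N−1))` and `wᵢ = lᵢ/N`. -/
theorem extended_nice_sampling_variance
    {d n : ℕ} (hn : 0 < n)
    (l : Fin n → ℕ) (hl : ∀ i, 0 < l i)
    (N : ℕ) (hN : N = ∑ i, l i) (hN2 : 2 ≤ N)
    (τ : ℕ) (hτ1 : 1 ≤ τ) (hτN : τ ≤ N)
    (idx : Fin N → Fin n)
    (hidx : ∀ i, (Finset.univ.filter fun j => idx j = i).card = l i)
    (a : Fin n → EuclideanSpace ℝ (Fin d)) :
    ((1 / (N.choose τ : ℝ)) •
        ∑ s ∈ Finset.powersetCard τ (Finset.univ : Finset (Fin N)),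
          (1 / (τ : ℝ)) • ∑ j ∈ s, ((N : ℝ) / ((n : ℝ) * (l (idx j) : ℝ))) • a (idx j))
      = (1 / (n : ℝ)) • ∑ i, a i
    ∧ (1 / (N.choose τ : ℝ)) *
        ∑ s ∈ Finset.powersetCard τ (Finset.univ : Finset (Fin N)),
          ‖(1 / (τ : ℝ)) • ∑ j ∈ s, ((N : ℝ) / ((n : ℝ) * (l (idx j) : ℝ))) • a (idx j)
              - (1 / (n : ℝ)) • ∑ i, a i‖ ^ 2
      = (((N : ℝ) - τ) / ((τ : ℝ) * ((N : ℝ) - 1)))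
          * ((∑ i, (1 / ((n : ℝ) ^ 2 * ((l i : ℝ) / (N : ℝ)))) * ‖a i‖ ^ 2)
              - ‖(1 / (n : ℝ)) • ∑ i, a i‖ ^ 2)
    ∧ (1 / (N.choose τ : ℝ)) *
        ∑ s ∈ Finset.powersetCard τ (Finset.univ : Finset (Fin N)),
          ‖(1 / (τ : ℝ)) • ∑ j ∈ s, ((N : ℝ) / ((n : ℝ) * (l (idx j) : ℝ))) • a (idx j)
              - (1 / (n : ℝ)) • ∑ i, a i‖ ^ 2
      ≤ ((((N : ℝ) - τ) / ((τ : ℝ) * ((N : ℝ) - 1))) / (n : ℝ))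
            * ∑ i, (1 / ((n : ℝ) * ((l i : ℝ) / (N : ℝ)))) * ‖a i‖ ^ 2
        - (((N : ℝ) - τ) / ((τ : ℝ) * ((N : ℝ) - 1)))
            * ‖(1 / (n : ℝ)) • ∑ i, a i‖ ^ 2 := by
  have hN' : (2 : ℝ) ≤ N := by exact_mod_cast hN2
  have q1 : (N : ℝ) ≠ 0 := by positivity
  have q2 : (N : ℝ) - 1 ≠ 0 := by linarith
  have q3 : (n : ℝ) ≠ 0 := by positivity
  have q4 : (τ : ℝ) ≠ 0 := by positivity
  have q5 : (N.choose τ : ℝ) ≠ 0 := by exact_mod_cast (Nat.choose_pos hτN).ne'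
  have q6 : ∀ i, (l i : ℝ) ≠ 0 := fun i => by exact_mod_cast (hl i).ne'
  set ā : EuclideanSpace ℝ (Fin d) := (1 / (n : ℝ)) • ∑ i, a i with hā
  set b : Fin N → EuclideanSpace ℝ (Fin d) :=
    fun j => ((N : ℝ) / ((n : ℝ) * (l (idx j) : ℝ))) • a (idx j) with hb
  have hfib : ∀ {E : Type} [AddCommGroup E] [Module ℝ E] (f : Fin n → E),
      ∑ j, f (idx j) = ∑ i, (l i : ℝ) • f i := by
    intro E _ _ f
    rw [← sum_fiberwise univ idx]
    refine sum_congr rfl fun i _ => ?_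
    rw [sum_congr rfl (g := fun _ => f i) (fun j hj => by rw [(mem_filter.1 hj).2]),
      sum_const, hidx, Nat.cast_smul_eq_nsmul]
  have hsb : ∑ j, b j = (N : ℝ) • ā := by
    rw [hb, hfib (fun i => ((N : ℝ) / ((n : ℝ) * (l i : ℝ))) • a i), hā, smul_smul, smul_sum]
    refine sum_congr rfl fun i _ => ?_
    rw [smul_smul]
    congr 1
    have := q6 i
    field_simp
  have hsq : ∑ j, ‖b j‖ ^ 2
      = N * ∑ i, (1 / ((n : ℝ) ^ 2 * ((l i : ℝ) / (N : ℝ)))) * ‖a i‖ ^ 2 := by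
    rw [hb, hfib (fun i => ‖((N : ℝ) / ((n : ℝ) * (l i : ℝ))) • a i‖ ^ 2), mul_sum]
    refine sum_congr rfl fun i _ => ?_
    rw [norm_smul, mul_pow, Real.norm_eq_abs, sq_abs, smul_eq_mul]
    have := q6 i
    field_simp
  have hc0 : ∑ j, (b j - ā) = 0 := by
    rw [sum_sub_distrib, hsb, sum_const, card_univ, Fintype.card_fin, Nat.cast_smul_eq_nsmul,
      sub_self]
  have hcsq : ∑ j, ‖b j - ā‖ ^ 2 = ∑ j, ‖b j‖ ^ 2 - N * ‖ā‖ ^ 2 := by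
    simp_rw [norm_sub_sq_real]
    rw [sum_add_distrib, sum_sub_distrib, ← mul_sum, ← sum_inner, hsb, real_inner_smul_left,
      real_inner_self_eq_norm_sq, sum_const, card_univ, Fintype.card_fin, nsmul_eq_mul]
    ring
  have hvar : (1 / (N.choose τ : ℝ)) *
        ∑ s ∈ Finset.powersetCard τ (Finset.univ : Finset (Fin N)),
          ‖(1 / (τ : ℝ)) • ∑ j ∈ s, b j - ā‖ ^ 2
      = (((N : ℝ) - τ) / ((τ : ℝ) * ((N : ℝ) - 1)))
          * ((∑ i, (1 / ((n : ℝ) ^ 2 * ((l i : ℝ) / (N : ℝ)))) * ‖a i‖ ^ 2) - ‖ā‖ ^ 2) := by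
    have h1 : ∀ s ∈ Finset.powersetCard τ (Finset.univ : Finset (Fin N)),
        ‖(1 / (τ : ℝ)) • ∑ j ∈ s, b j - ā‖ ^ 2
          = (1 / (τ : ℝ)) ^ 2 * ‖∑ j ∈ s, (b j - ā)‖ ^ 2 := by
      intro s hs
      have e : (1 / (τ : ℝ)) • ∑ j ∈ s, b j - ā = (1 / (τ : ℝ)) • ∑ j ∈ s, (b j - ā) := by
        rw [sum_sub_distrib, sum_const, (mem_powersetCard.1 hs).2, smul_sub,
          ← Nat.cast_smul_eq_nsmul ℝ, smul_smul, one_div_mul_cancel q4, one_smul]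
      rw [e, norm_smul, mul_pow, Real.norm_eq_abs, sq_abs]
    rw [sum_congr rfl h1, ← mul_sum, ens_sum_two hN2 hτ1 _ hc0, hcsq, hsq]
    field_simp
  refine ⟨?_, hvar, ?_⟩
  · rw [← smul_sum, ens_sum_one hN2 hτ1 b, hsb, smul_smul, smul_smul, smul_smul]
    convert one_smul ℝ ā using 2
    field_simp
  · rw [hvar]
    apply le_of_eq
    have e : ∀ i, (1 / ((n : ℝ) ^ 2 * ((l i : ℝ) / (N : ℝ)))) * ‖a i‖ ^ 2
        = (1 / ((n : ℝ) * ((l i : ℝ) / (N : ℝ)))) * ‖a i‖ ^ 2 / n := by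
      intro i
      have := q6 i
      field_simp
    rw [sum_congr rfl (fun i _ => e i), ← sum_div]
    ring
end
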